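/- Let p be an odd prime, q = p^n, and let ℓ be a prime and r ≥ 1 an integer such that SL_2(F_q) contains an element of order ℓ^r. If q ≡ 1 (mod ℓ^r) or q ≡ −1 (mod ℓ^r), then K_{ℓ^r}(SL_2(F_q)) = ℚ(ζ_{ℓ^r} + ζ_{ℓ^r}^{−1}); if q ≡ 0 (mod ℓ^r), then K_{ℓ^r}(SL_2(F_q)) = ℚ(√(q*)), where q* := (−1)^{(q−1)/2} q. -/

import Mathlib

open CategoryTheory

/-- `zeta N` is the root of unity `e^{2 π i / N}`. -/
noncomputable def zeta (N : ℕ) : ℂ := Complex.exp (2 * Real.pi * Complex.I / N)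

/-- `charField G` is the field `K(G)` generated over `ℚ` by all values of
irreducible complex characters of `G`. -/
noncomputable def charField (G : Type) [Group G] : IntermediateField ℚ ℂ :=
  IntermediateField.adjoin ℚ
    {x : ℂ | ∃ V : FDRep ℂ G, Simple V ∧ ∃ g : G, V.character g = x}

/-- `charFieldAt G d` is the field `K_d(G)` generated over `ℚ` by the values of
irreducible complex characters of `G` at elements of order exactly `d`. -/
noncomputable def charFieldAt (G : Type) [Group G] (d : ℕ) : IntermediateField ℚ ℂ :=
  IntermediateField.adjoin ℚ
    {x : ℂ | ∃ V : FDRep ℂ G, Simple V ∧ ∃ g : G, orderOf g = d ∧ V.character g = x}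


section
open Representation

theorem FDRep.simple_of_isIrreducible {G V : Type} [Group G] [Finite G] [AddCommGroup V]
    [Module ℂ V] [FiniteDimensional ℂ V] (ρ : Representation ℂ G V) [ρ.IsIrreducible] :
    Simple (FDRep.of ρ) := by
  have := Fintype.ofFinite G
  have hne : (Nat.card G : ℂ) ≠ 0 := by simp
  have := invertibleOfNonzero hne
  rw [FDRep.simple_iff_char_is_norm_one]
  have h := Representation.char_orthonormal ρ ρ
  rw [if_pos ⟨Representation.Equiv.refl ρ⟩, inv_mul_eq_one₀ hne] at h
  exact h.symm

theorem Representation.IsIrreducible.eq_zero_of_trace_eq_zero {G V : Type} [Group G] [Finite G]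
    [AddCommGroup V] [Module ℂ V] [FiniteDimensional ℂ V] (ρ : Representation ℂ G V)
    [ρ.IsIrreducible] (T : V →ₗ[ℂ] V) (hT : ∀ g, T ∘ₗ ρ g = ρ g ∘ₗ T)
    (htr : LinearMap.trace ℂ V T = 0) : T = 0 := by
  obtain ⟨c, hc⟩ := (Representation.IsIrreducible.algebraMap_intertwiningMap_bijective_of_isAlgClosed
    (ρ := ρ)).2 ⟨T, hT⟩
  have hc' : T = c • LinearMap.id := by
    ext x
    exact (congrArg (fun f : IntertwiningMap ρ ρ => f x) hc).symm
  rw [hc'] at htr ⊢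
  simp only [map_smul, LinearMap.trace_id, smul_eq_mul, mul_eq_zero, Nat.cast_eq_zero] at htr
  rcases htr with h | h
  · simp [h]
  · have := Module.finrank_zero_iff.1 h
    exact Subsingleton.elim _ _

theorem Representation.asAlgebraHom_ofModule' {G V : Type*} [Group G] [AddCommGroup V] [Module ℂ V]
    [Module (MonoidAlgebra ℂ G) V] [IsScalarTower ℂ (MonoidAlgebra ℂ G) V]
    (r : MonoidAlgebra ℂ G) (v : V) :
    (ofModule' (k := ℂ) (G := G) V).asAlgebraHom r v = r • v := by
  simp [asAlgebraHom, ofModule']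

theorem Representation.isIrreducible_ofModule' {G V : Type*} [Group G] [AddCommGroup V] [Module ℂ V]
    [Module (MonoidAlgebra ℂ G) V] [IsScalarTower ℂ (MonoidAlgebra ℂ G) V]
    [IsSimpleModule (MonoidAlgebra ℂ G) V] : (ofModule' (k := ℂ) (G := G) V).IsIrreducible := by
  rw [irreducible_iff_isSimpleModule_asModule]
  exact IsSimpleModule.congr (N := V)
    { (ofModule' (k := ℂ) (G := G) V).asModuleEquiv.toAddEquiv with
      map_smul' := fun r x => by
        simp [asAlgebraHom_ofModule'] }

/-- The difference of the conjugation averages of `g` and `h` in the group algebra. -/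
noncomputable def conjDiff {G : Type} [Group G] [Fintype G] (g h : G) : MonoidAlgebra ℂ G :=
  ∑ y : G, (MonoidAlgebra.of ℂ G (y * g * y⁻¹) - MonoidAlgebra.of ℂ G (y * h * y⁻¹))

theorem conjDiff_smul_eq_zero {G V : Type} [Group G] [Fintype G] [AddCommGroup V] [Module ℂ V]
    [FiniteDimensional ℂ V] [Module (MonoidAlgebra ℂ G) V]
    [IsScalarTower ℂ (MonoidAlgebra ℂ G) V] [IsSimpleModule (MonoidAlgebra ℂ G) V] {g h : G}
    (H : ∀ V : FDRep ℂ G, Simple V → V.character g = V.character h) (v : V) :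
    conjDiff g h • v = 0 := by
  let ρ : Representation ℂ G V := ofModule' V
  have : ρ.IsIrreducible := isIrreducible_ofModule'
  have hz : ρ.asAlgebraHom (conjDiff g h) = ∑ y : G, (ρ (y * g * y⁻¹) - ρ (y * h * y⁻¹)) := by
    rw [conjDiff, map_sum]
    refine Finset.sum_congr rfl fun y _ => ?_
    rw [map_sub, asAlgebraHom_of, asAlgebraHom_of]
  have hT : ρ.asAlgebraHom (conjDiff g h) = 0 := by
    refine IsIrreducible.eq_zero_of_trace_eq_zero ρ _ (fun k => ?_) ?_
    · change ρ.asAlgebraHom (conjDiff g h) * ρ k = ρ k * ρ.asAlgebraHom (conjDiff g h)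
      rw [hz, Finset.sum_mul, Finset.mul_sum]
      refine Fintype.sum_equiv (Equiv.mulLeft k⁻¹) _ _ fun y => ?_
      rw [sub_mul, mul_sub, ← map_mul, ← map_mul, ← map_mul, ← map_mul, Equiv.coe_mulLeft]
      congr 2 <;> group
    · rw [hz, map_sum]
      refine Finset.sum_eq_zero fun y _ => ?_
      have h1 := H _ (FDRep.simple_of_isIrreducible ρ)
      rw [map_sub, sub_eq_zero]
      exact (char_conj ρ g y).trans (h1.trans (char_conj ρ h y).symm)
  rw [← asAlgebraHom_ofModule']
  exact LinearMap.congr_fun hT v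

theorem isConj_of_forall_character_eq {G : Type} [Group G] [Finite G] {g h : G}
    (H : ∀ V : FDRep ℂ G, Simple V → V.character g = V.character h) : IsConj g h := by
  classical
  have := Fintype.ofFinite G
  have hz0 : conjDiff g h = 0 := by
    have key (m : Submodule (MonoidAlgebra ℂ G) (MonoidAlgebra ℂ G))
        (hm : IsSimpleModule (MonoidAlgebra ℂ G) m) (x : MonoidAlgebra ℂ G) (hx : x ∈ m) :
        conjDiff g h * x = 0 := by
      have : FiniteDimensional ℂ m := inferInstanceAs (FiniteDimensional ℂ (m.restrictScalars ℂ))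
      exact congrArg Subtype.val (conjDiff_smul_eq_zero H (⟨x, hx⟩ : m))
    have htop : (1 : MonoidAlgebra ℂ G) ∈
        sSup {m : Submodule (MonoidAlgebra ℂ G) (MonoidAlgebra ℂ G) |
          IsSimpleModule (MonoidAlgebra ℂ G) m} := by
      rw [IsSemisimpleModule.sSup_simples_eq_top]
      trivial
    rw [sSup_eq_iSup'] at htop
    rw [← mul_one (conjDiff g h)]
    generalize (1 : MonoidAlgebra ℂ G) = u at htop ⊢
    induction htop using Submodule.iSup_induction' with
    | mem m x hx => exact key m m.2 x hx
    | zero => exact mul_zero _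
    | add x y _ _ hx hy => rw [mul_add, hx, hy, add_zero]
  by_contra hc
  have h1 : (conjDiff g h).coeff g = ∑ y : G, if y * g * y⁻¹ = g then (1 : ℂ) else 0 := by
    have hne (y : G) : y * h * y⁻¹ ≠ g := fun he => hc (isConj_iff.2 ⟨y, he⟩).symm
    rw [conjDiff]
    simp [MonoidAlgebra.coeff_sum, MonoidAlgebra.of_apply, Finsupp.single_apply, hne]
  rw [hz0, Finset.sum_boole] at h1
  have h2 : Finset.univ.filter (fun y : G => y * g * y⁻¹ = g) = ∅ := by
    simpa using h1.symm
  have h3 : (1 : G) ∈ Finset.univ.filter (fun y : G => y * g * y⁻¹ = g) := by simp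
  rw [h2] at h3
  simp at h3
end
open Polynomial in
theorem exists_polynomial_trace_pow {V : Type} [AddCommGroup V] [Module ℂ V]
    [FiniteDimensional ℂ V] (f : Module.End ℂ V) {d : ℕ} (hd : d ≠ 0) (hf : f ^ d = 1) {ζ : ℂ}
    (hζ : IsPrimitiveRoot ζ d) :
    ∃ P : ℚ[X], ∀ t : ℕ, LinearMap.trace ℂ V (f ^ t) = aeval (ζ ^ t) P := by
  have hss : f.IsSemisimple := by
    refine Module.End.isSemisimple_of_squarefree_aeval_eq_zero (p := X ^ d - 1) ?_ (by simp [hf])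
    exact (X_pow_sub_one_separable_iff.2 (by exact_mod_cast hd)).squarefree
  have hint : DirectSum.IsInternal f.eigenspace :=
    DirectSum.isInternal_submodule_of_iSupIndep_of_iSup_eq_top f.eigenspaces_iSupIndep hss.iSup_eigenspace_eq_top
  have hpow (t : ℕ) (μ : ℂ) (v : V) (hv : v ∈ f.eigenspace μ) : (f ^ t) v = μ ^ t • v := by
    induction t with
    | zero => simp
    | succ t ih =>
      rw [pow_succ', Module.End.mul_apply, ih, map_smul, Module.End.mem_eigenspace_iff.1 hv, smul_smul, pow_succ]
  have hfin : {μ | f.eigenspace μ ≠ ⊥}.Finite :=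
    WellFoundedGT.finite_ne_bot_of_iSupIndep f.eigenspaces_iSupIndep
  have hex (μ : ℂ) : ∃ i : ℕ, f.eigenspace μ ≠ ⊥ → ζ ^ i = μ := by
    by_cases h : f.eigenspace μ = ⊥
    · exact ⟨0, fun h' => (h' h).elim⟩
    · obtain ⟨v, hv, hv0⟩ := Submodule.exists_mem_ne_zero_of_ne_bot h
      have h1 : μ ^ d = 1 := by
        have := hpow d μ v hv
        rw [hf, Module.End.one_apply] at this
        have h2 : (μ ^ d - 1) • v = 0 := by rw [sub_smul, one_smul, ← this, sub_self]
        exact sub_eq_zero.1 ((smul_eq_zero.1 h2).resolve_right hv0)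
      have : NeZero d := ⟨hd⟩
      obtain ⟨i, -, hi⟩ := hζ.eq_pow_of_pow_eq_one h1
      exact ⟨i, fun _ => hi⟩
  choose i hi using hex
  refine ⟨∑ μ ∈ hfin.toFinset, C (Module.finrank ℂ (f.eigenspace μ) : ℚ) * X ^ (i μ), fun t => ?_⟩
  have hmaps (μ : ℂ) : Set.MapsTo (f ^ t) (f.eigenspace μ) (f.eigenspace μ) := fun v hv => by
    rw [hpow t μ v hv]
    exact Submodule.smul_mem _ _ hv
  rw [LinearMap.trace_eq_sum_trace_restrict' hint hfin hmaps, map_sum]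
  refine Finset.sum_congr rfl fun μ hμ => ?_
  have h1 : (f ^ t).restrict (hmaps μ) = μ ^ t • LinearMap.id := by
    ext v
    exact hpow t μ v v.2
  rw [h1, map_smul, LinearMap.trace_id]
  have h2 : (ζ ^ t) ^ i μ = μ ^ t := by
    rw [← pow_mul, mul_comm, pow_mul, hi μ (by simpa using hμ)]
  simp [h2, mul_comm]

open Polynomial IntermediateField in
theorem adjoin_aeval_le_of_galois {K Ω : Type*} [Field K] [Field Ω] [Algebra K Ω] {d : ℕ}
    [NeZero d] {ζ : Ω} (hζ : IsPrimitiveRoot ζ d)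
    {S T : Set K[X]} (H : ∀ t : ℕ, t.Coprime d → (∀ P ∈ S, aeval (ζ ^ t) P = aeval ζ P) →
      ∀ P ∈ T, aeval (ζ ^ t) P = aeval ζ P) :
    adjoin K ((fun P => aeval ζ P) '' T) ≤ adjoin K ((fun P => aeval ζ P) '' S) := by
  have hint : IsIntegral K ζ := (hζ.isIntegral (NeZero.pos d)).tower_top
  have hcyc : IsCyclotomicExtension {d} K K⟮ζ⟯ := by
    have := hζ.adjoin_isCyclotomicExtension K
    change IsCyclotomicExtension {d} K K⟮ζ⟯.toSubalgebra
    rwa [adjoin_simple_toSubalgebra_of_isAlgebraic hint.isAlgebraic]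
  have : IsGalois K K⟮ζ⟯ := IsCyclotomicExtension.isGalois {d} K K⟮ζ⟯
  have : FiniteDimensional K K⟮ζ⟯ := adjoin.finiteDimensional hint
  set z : K⟮ζ⟯ := AdjoinSimple.gen K ζ with hz
  have hzp : IsPrimitiveRoot z d := by
    rw [← IsPrimitiveRoot.coe_submonoidClass_iff]
    exact hζ
  have hcoe (t : ℕ) (P : K[X]) : ((aeval (z ^ t) P : K⟮ζ⟯) : Ω) = aeval (ζ ^ t) P := by
    have := aeval_algHom_apply K⟮ζ⟯.val (z ^ t) P
    simpa [hz] using this.symm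
  set E : IntermediateField K K⟮ζ⟯ := adjoin K ((fun P => aeval z P) '' S) with hE
  have hmap : E.map K⟮ζ⟯.val = adjoin K ((fun P => aeval ζ P) '' S) := by
    rw [hE, adjoin_map, ← Set.image_comp]
    congr 1
    refine Set.image_congr fun P _ => ?_
    simp [hz]
  rw [adjoin_le_iff]
  rintro _ ⟨P, hP, rfl⟩
  rw [← hmap]
  refine ⟨aeval z P, ?_, by simpa using hcoe 1 P⟩
  change aeval z P ∈ E
  rw [← IsGalois.fixedField_fixingSubgroup E]
  rintro ⟨σ, hσ⟩
  change σ (aeval z P) = aeval z P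
  obtain ⟨t, -, ht, hσz⟩ := hzp.isPrimitiveRoot_iff.1 (hzp.map_of_injective σ.injective)
  have hσP (Q : K[X]) : σ (aeval z Q) = aeval (z ^ t) Q := by
    rw [hσz]; exact (aeval_algHom_apply σ.toAlgHom z Q).symm
  have h2 := H t ht (fun Q hQ => ?_) P hP
  · rw [hσP]
    apply Subtype.ext
    have := hcoe 1 P
    simp only [pow_one] at this
    rw [hcoe, h2, this]
  · have h3 := (_root_.mem_fixingSubgroup_iff _).1 hσ (aeval z Q) (subset_adjoin _ _ ⟨Q, hQ, rfl⟩)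
    have h4 : σ (aeval z Q) = aeval z Q := h3
    rw [hσP] at h4
    have := congrArg (fun x : K⟮ζ⟯ => (x : Ω)) h4
    simp only [hcoe] at this
    have h5 := hcoe 1 Q
    simp only [pow_one] at h5
    rwa [h5] at this

theorem isPrimitiveRoot_zeta (N : ℕ) [NeZero N] : IsPrimitiveRoot (zeta N) N :=
  Complex.isPrimitiveRoot_exp N (NeZero.ne N)

open Polynomial in
/-- The field `K_d(G)` is generated by any element of `ℚ(ζ_d)` whose stabiliser in the Galois
group consists of the `t` such that `g ^ t` is conjugate to `g` for all `g` of order `d`. -/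
theorem charFieldAt_eq_adjoin {G : Type} [Group G] [Finite G] {d : ℕ} [NeZero d] (Q : ℚ[X])
    (H : ∀ t : ℕ, t.Coprime d → (aeval (zeta d ^ t) Q = aeval (zeta d) Q ↔
      ∀ g : G, orderOf g = d → IsConj (g ^ t) g)) :
    charFieldAt G d = IntermediateField.adjoin ℚ {aeval (zeta d) Q} := by
  have hζ := isPrimitiveRoot_zeta d
  set S : Set ℚ[X] := {P | ∃ V : FDRep ℂ G, Simple V ∧ ∃ g : G, orderOf g = d ∧
    ∀ t : ℕ, V.character (g ^ t) = aeval (zeta d ^ t) P} with hS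
  have hex (V : FDRep ℂ G) (g : G) (hg : orderOf g = d) :
      ∃ P : ℚ[X], ∀ t : ℕ, V.character (g ^ t) = aeval (zeta d ^ t) P := by
    obtain ⟨P, hP⟩ := exists_polynomial_trace_pow (V.ρ g) (NeZero.ne d)
      (by rw [← map_pow, ← hg, pow_orderOf_eq_one, map_one]) hζ
    exact ⟨P, fun t => by rw [← hP, FDRep.character, map_pow]⟩
  have h1 : charFieldAt G d = IntermediateField.adjoin ℚ ((fun P => aeval (zeta d) P) '' S) := by
    rw [charFieldAt]
    congr 1
    ext x
    constructor
    · rintro ⟨V, hV, g, hg, rfl⟩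
      obtain ⟨P, hP⟩ := hex V g hg
      exact ⟨P, ⟨V, hV, g, hg, hP⟩, by simpa using (hP 1).symm⟩
    · rintro ⟨P, ⟨V, hV, g, hg, hP⟩, rfl⟩
      exact ⟨V, hV, g, hg, by simpa using hP 1⟩
  have h2 (t : ℕ) : (∀ P ∈ S, aeval (zeta d ^ t) P = aeval (zeta d) P) ↔
      ∀ g : G, orderOf g = d → IsConj (g ^ t) g := by
    constructor
    · refine fun h g hg => isConj_of_forall_character_eq fun V hV => ?_
      obtain ⟨P, hP⟩ := hex V g hg
      rw [hP, h P ⟨V, hV, g, hg, hP⟩]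
      simpa using (hP 1).symm
    · rintro h P ⟨V, hV, g, hg, hP⟩
      obtain ⟨c, hc⟩ := isConj_iff.1 (h g hg)
      rw [← hP, ← FDRep.char_conj V _ c, hc]
      simpa using hP 1
  rw [h1, ← Set.image_singleton (f := fun P => aeval (zeta d) P)]
  refine le_antisymm (adjoin_aeval_le_of_galois hζ fun t ht h => ?_)
    (adjoin_aeval_le_of_galois hζ fun t ht h => ?_)
  · rw [h2, ← H t ht]
    exact h Q rfl
  · rintro _ rfl
    rwa [H t ht, ← h2]

namespace Matrix.SpecialLinearGroup

variable {F : Type*} [Field F]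

theorem isConj_of_mul_eq {A B : SpecialLinearGroup (Fin 2) F} (M : Matrix (Fin 2) (Fin 2) F)
    (hM : M.det = 1) (h : M * A.1 = B.1 * M) : IsConj A B :=
  isConj_iff.2 ⟨⟨M, hM⟩, mul_inv_eq_iff_eq_mul.2 (Subtype.ext h)⟩

theorem sub_one_sq_eq_zero {g : SpecialLinearGroup (Fin 2) F} (hg : g.1.trace = 2) :
    (g.1 - 1) ^ 2 = 0 := by
  have hdet := g.det_coe
  rw [det_fin_two] at hdet
  rw [trace_fin_two] at hg
  have hd : g.1 1 1 = 2 - g.1 0 0 := by linear_combination hg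
  rw [hd] at hdet
  rw [sq]
  ext i j
  fin_cases i <;> fin_cases j <;> simp [Matrix.mul_apply, Fin.sum_univ_two, hd] <;>
    first | ring1 | linear_combination - hdet

theorem pow_char_eq_one {p : ℕ} [Fact p.Prime] [CharP F p]
    {g : SpecialLinearGroup (Fin 2) F} (hg : g.1.trace = 2) : g ^ p = 1 := by
  have := Matrix.charP (R := F) (n := Fin 2) p
  have h1 := sub_pow_char_of_commute (R := Matrix (Fin 2) (Fin 2) F) (p := p)
    (Commute.one_right g.1)
  rw [one_pow, pow_eq_zero_of_le (Fact.out : p.Prime).two_le (sub_one_sq_eq_zero hg)] at h1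
  exact Subtype.ext (sub_eq_zero.1 h1.symm)

theorem trace_eq_two_of_pow_char_pow_eq_one {p r : ℕ} [Fact p.Prime] [CharP F p]
    {g : SpecialLinearGroup (Fin 2) F} (hg : g ^ p ^ r = 1) : g.1.trace = 2 := by
  have := Matrix.charP (R := F) (n := Fin 2) p
  have h1 := sub_pow_char_pow_of_commute (R := Matrix (Fin 2) (Fin 2) F) (p := p) (n := r)
    (Commute.one_right g.1)
  have h2 : g.1 ^ p ^ r = 1 := congrArg Subtype.val hg
  rw [one_pow, h2, sub_self] at h1
  have h3 := (isNilpotent_trace_of_isNilpotent ⟨_, h1⟩).eq_zero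
  rw [trace_sub, sub_eq_zero] at h3
  simpa using h3

theorem eq_one_of_trace_eq_two {p d : ℕ} [Fact p.Prime] [CharP F p]
    {g : SpecialLinearGroup (Fin 2) F} (hg : g.1.trace = 2) (hd : g ^ d = 1)
    (hpd : p.Coprime d) : g = 1 := by
  have := Nat.dvd_gcd (orderOf_dvd_of_pow_eq_one (pow_char_eq_one (p := p) hg))
    (orderOf_dvd_of_pow_eq_one hd)
  rwa [hpd, Nat.dvd_one, orderOf_eq_one_iff] at this

theorem isConj_inv_of_trace_ne [Finite F] (hchar : ringChar F ≠ 2)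
    {g : SpecialLinearGroup (Fin 2) F} (h2 : g.1.trace ≠ 2) (h2' : g.1.trace ≠ -2) :
    IsConj g g⁻¹ := by
  have := Fintype.ofFinite F
  suffices ∃ x y z : F, x * (g.1 0 0 - g.1 1 1) + y * g.1 1 0 + z * g.1 0 1 = 0 ∧
      - x ^ 2 - y * z = 1 by
    obtain ⟨x, y, z, h0, h1⟩ := this
    refine isConj_of_mul_eq !![x, y; z, -x] (by rw [det_fin_two_of]; linear_combination h1) ?_
    rw [coe_inv, adjugate_fin_two]
    ext i j
    fin_cases i <;> fin_cases j <;> simp [Matrix.mul_apply, Fin.sum_univ_two] <;>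
      first | ring1 | linear_combination h0
  have hdet := g.det_coe
  rw [det_fin_two] at hdet
  rw [trace_fin_two] at h2 h2'
  generalize g.1 0 0 = a at *
  generalize g.1 0 1 = b at *
  generalize g.1 1 0 = c at *
  generalize g.1 1 1 = d at *
  have hdisc : (a - d) ^ 2 + 4 * b * c ≠ 0 := by
    have : (a - d) ^ 2 + 4 * b * c = (a + d - 2) * (a + d + 2) := by linear_combination -4 * hdet
    rw [this]
    exact mul_ne_zero (sub_ne_zero.2 h2) fun h => h2' (eq_neg_of_add_eq_zero_left h)
  have htwo : (2 : F) ≠ 0 := Ring.two_ne_zero hchar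
  by_cases hc : c = 0
  · by_cases hb : b = 0
    · exact ⟨0, 1, -1, by simp [hb, hc], by simp⟩
    · have had : a - d ≠ 0 := fun h => hdisc (by rw [h, hc]; ring)
      exact ⟨1, 2 * b / (a - d), -((a - d) / b), by field_simp; rw [hc]; ring, by field_simp; ring⟩
  · have h4 : (4 : F) ≠ 0 := by
      have : (4 : F) = 2 * 2 := by norm_num
      rw [this]; exact mul_ne_zero htwo htwo
    obtain ⟨s, z, hsz⟩ := FiniteField.exists_root_sum_quadratic (R := F)
      (f := Polynomial.C (-1) * Polynomial.X ^ 2 + Polynomial.C 0 * Polynomial.X + Polynomial.C (-1))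
      (g := Polynomial.C (((a - d) ^ 2 + 4 * b * c) / (4 * c ^ 2)) * Polynomial.X ^ 2 +
        Polynomial.C 0 * Polynomial.X + Polynomial.C 0)
      (Polynomial.degree_quadratic (by simp))
      (Polynomial.degree_quadratic (div_ne_zero hdisc (mul_ne_zero h4 (pow_ne_zero 2 hc))))
      (FiniteField.odd_card_of_char_ne_two hchar)
    simp only [Polynomial.eval_add, Polynomial.eval_mul, Polynomial.eval_C, Polynomial.eval_pow,
      Polynomial.eval_X, zero_mul, add_zero] at hsz
    refine ⟨s + (a - d) / (2 * c) * z, -((s + (a - d) / (2 * c) * z) * (a - d) + z * b) / c, z, ?_, ?_⟩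
    · field_simp; ring
    · rw [← sub_eq_zero, ← hsz]
      field_simp
      ring

theorem isConj_inv_of_pow_eq_one [Finite F] {p d : ℕ} [Fact p.Prime] [CharP F p] (hp : Odd p)
    {g : SpecialLinearGroup (Fin 2) F} (hd : g ^ d = 1) (hpd : p.Coprime d) : IsConj g g⁻¹ := by
  by_cases h2 : g.1.trace = 2
  · rw [eq_one_of_trace_eq_two h2 hd hpd, inv_one]
  by_cases h2' : g.1.trace = -2
  · have h1 : -g = 1 := eq_one_of_trace_eq_two (p := p) (d := 2 * d) (by simp [h2'])
      (by rw [pow_mul, neg_sq, ← pow_mul, mul_comm, pow_mul, hd, one_pow])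
      (Nat.Coprime.mul_right (Nat.coprime_two_right.2 hp) hpd)
    rw [neg_eq_iff_eq_neg.1 h1, inv_neg, inv_one]
  · refine isConj_inv_of_trace_ne ?_ h2 h2'
    rw [ringChar.eq F p]
    rintro rfl
    exact absurd hp (by decide)

theorem exists_trace_pow_eq (g : SpecialLinearGroup (Fin 2) F) :
    ∃ l : AlgebraicClosure F, l ≠ 0 ∧
      ∀ k : ℕ, algebraMap F (AlgebraicClosure F) (g ^ k).1.trace = l ^ k + (l ^ k)⁻¹ := by
  obtain ⟨l, hl⟩ := IsAlgClosed.exists_root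
    (Polynomial.C 1 * Polynomial.X ^ 2 + Polynomial.C (-algebraMap F (AlgebraicClosure F) g.1.trace) * Polynomial.X +
      Polynomial.C 1) (by rw [Polynomial.degree_quadratic one_ne_zero]; decide)
  simp only [Polynomial.IsRoot, Polynomial.eval_add, Polynomial.eval_mul, Polynomial.eval_C,
    Polynomial.eval_pow, Polynomial.eval_X] at hl
  have hl0 : l ≠ 0 := by
    rintro rfl
    simp at hl
  refine ⟨l, hl0, fun k => ?_⟩
  have hg : algebraMap F (AlgebraicClosure F) g.1.trace = l + l⁻¹ := by
    field_simp
    linear_combination -hl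
  have hrec (k : ℕ) : (g ^ (k + 2)).1.trace = g.1.trace * (g ^ (k + 1)).1.trace - (g ^ k).1.trace := by
    have hch : g.1 ^ 2 = g.1.trace • g.1 - 1 := by
      have hdet := g.det_coe
      rw [det_fin_two] at hdet
      rw [sq, trace_fin_two]
      ext i j
      fin_cases i <;> fin_cases j <;> simp [Matrix.mul_apply, Fin.sum_univ_two] <;>
        first | ring1 | linear_combination - hdet
    have h1 : (g ^ (k + 2)).1 = g.1.trace • (g ^ (k + 1)).1 - (g ^ k).1 := by
      rw [coe_pow, coe_pow, coe_pow, pow_add, hch, mul_sub, mul_one, mul_smul_comm, ← pow_succ]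
    rw [h1, trace_sub, trace_smul, smul_eq_mul]
  induction k using Nat.twoStepInduction with
  | zero => simp [map_ofNat]; norm_num
  | one => simpa using hg
  | more k h0 h1 =>
    rw [hrec, map_sub, map_mul, h1, h0, hg]
    field_simp
    ring

theorem coe_pow_eq_of_trace_eq_two {g : SpecialLinearGroup (Fin 2) F} (hg : g.1.trace = 2)
    (t : ℕ) : (g ^ t).1 = 1 + (t : F) • (g.1 - 1) := by
  have hN := sub_one_sq_eq_zero hg
  rw [sq] at hN
  induction t with
  | zero => simp
  | succ t ih =>
    rw [pow_succ, coe_mul, ih]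
    calc (1 + (t : F) • (g.1 - 1)) * g.1
        = (1 + (t : F) • (g.1 - 1)) * (1 + (g.1 - 1)) := by rw [add_sub_cancel]
      _ = 1 + ((t : F) • (g.1 - 1) + (g.1 - 1)) + (t : F) • ((g.1 - 1) * (g.1 - 1)) := by
        rw [mul_add, mul_one, add_mul, one_mul, smul_mul_assoc]
        abel
      _ = _ := by
        rw [hN, smul_zero, add_zero, Nat.cast_succ, add_smul, one_smul]

theorem isConj_pow_of_trace_eq_two {g : SpecialLinearGroup (Fin 2) F} (hg : g.1.trace = 2)
    {t : ℕ} {w : F} (hw : w ≠ 0) (ht : (t : F) = w ^ 2) : IsConj (g ^ t) g := by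
  have hN := sub_one_sq_eq_zero hg
  have hpow := coe_pow_eq_of_trace_eq_two hg t
  rw [ht] at hpow
  have hdet := g.det_coe
  rw [det_fin_two] at hdet
  rw [trace_fin_two] at hg
  have hd : g.1 1 1 = 2 - g.1 0 0 := by linear_combination hg
  rw [hd] at hdet
  refine IsConj.symm ?_
  by_cases hc : g.1 1 0 = 0
  · have ha : g.1 0 0 = 1 := by
      have : (g.1 0 0 - 1) ^ 2 = 0 := by rw [hc] at hdet; linear_combination -hdet
      exact sub_eq_zero.1 (pow_eq_zero_iff two_ne_zero |>.1 this)
    refine isConj_of_mul_eq !![w, 0; 0, w⁻¹] (by rw [det_fin_two_of]; field_simp; simp) ?_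
    rw [hpow]
    ext i j
    fin_cases i <;> fin_cases j <;> simp [Matrix.mul_apply, Fin.sum_univ_two, hc, ha, hd] <;>
      (field_simp; try ring)
  · refine isConj_of_mul_eq !![w⁻¹, (g.1 0 0 - 1) * (w - w⁻¹) / g.1 1 0; 0, w]
      (by rw [det_fin_two_of]; field_simp; simp) ?_
    rw [hpow]
    ext i j
    fin_cases i <;> fin_cases j <;> simp [Matrix.mul_apply, Fin.sum_univ_two, hd] <;>
      field_simp <;> first | ring1 | linear_combination (w ^ 4 - 1) * hdet

/-- The standard unipotent element of `SL₂`. -/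
def unipotent (F : Type*) [Field F] : SpecialLinearGroup (Fin 2) F :=
  ⟨!![1, 1; 0, 1], by simp [det_fin_two_of]⟩

theorem trace_unipotent : (unipotent F).1.trace = 2 := by
  norm_num [unipotent, trace_fin_two]

theorem orderOf_unipotent {p : ℕ} [Fact p.Prime] [CharP F p] : orderOf (unipotent F) = p := by
  refine orderOf_eq_prime (pow_char_eq_one trace_unipotent) fun h => ?_
  have := congrFun (congrFun (congrArg Subtype.val h) 0) 1
  simp [unipotent] at this

theorem exists_sq_eq_of_isConj_unipotent_pow {t : ℕ} (h : IsConj (unipotent F ^ t) (unipotent F)) :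
    ∃ w : F, w ≠ 0 ∧ (t : F) = w ^ 2 := by
  obtain ⟨c, hc⟩ := isConj_iff.1 h.symm
  rw [mul_inv_eq_iff_eq_mul] at hc
  have h1 := congrArg Subtype.val hc
  change c.1 * (unipotent F).1 = (unipotent F ^ t).1 * c.1 at h1
  rw [coe_pow_eq_of_trace_eq_two trace_unipotent] at h1
  have hdet := c.det_coe
  rw [det_fin_two] at hdet
  have h01 := congrFun (congrFun h1 0) 1
  have h11 := congrFun (congrFun h1 1) 1
  simp [unipotent, Matrix.mul_apply, Fin.sum_univ_two] at h01 h11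
  have h00 : c.1 0 0 = t * c.1 1 1 := by linear_combination h01
  rw [h11, h00] at hdet
  refine ⟨c.1 0 0, fun h0 => ?_, ?_⟩
  · rw [← h00, h0] at hdet; simp at hdet
  · rw [h00]; linear_combination (-(t : F)) * hdet

end Matrix.SpecialLinearGroup

open Polynomial in
/-- Every square root of `q* = (-1) ^ ((q - 1) / 2) * q` is, up to sign, a quadratic Gauss sum,
on which the Galois group acts through the quadratic character. -/
theorem exists_polynomial_aeval_eq_sqrt {F : Type*} [Field F] [Fintype F] {p : ℕ} [Fact p.Prime]
    [CharP F p] (hp : p ≠ 2) {s : ℂ}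
    (hs : s ^ 2 = (-1) ^ ((Fintype.card F - 1) / 2) * (Fintype.card F : ℂ)) {ζ : ℂ}
    (hζ : IsPrimitiveRoot ζ p) :
    ∃ Q : ℚ[X], aeval ζ Q = s ∧ ∀ t : ℕ, t.Coprime p →
      ∃ e : ℤ, (e = 1 ↔ IsSquare (t : F)) ∧ (e : ℂ) * aeval (ζ ^ t) Q = s := by
  classical
  have hchar : ringChar F ≠ 2 := by rwa [ringChar.eq F p]
  let χ : MulChar F ℂ := (quadraticChar F).ringHomComp (Int.castRingHom ℂ)
  have hχ : χ.IsQuadratic := (quadraticChar_isQuadratic F).comp _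
  have hχ1 : χ ≠ 1 := by
    refine (MulChar.ringHomComp_ne_one_iff Int.cast_injective).2 (quadraticChar_ne_one hchar)
  let ψ := AddChar.FiniteField.primitiveChar_to_Complex F
  have hψ : ψ.IsPrimitive := AddChar.FiniteField.primitiveChar_to_Complex_isPrimitive F
  have hsq : gaussSum χ ψ ^ 2 = s ^ 2 := by
    rw [gaussSum_sq hχ1 hχ hψ, hs]
    congr 1
    have h1 := quadraticChar_neg_one hchar
    have hodd := FiniteField.odd_card_of_char_ne_two hchar
    rw [ZMod.χ₄_eq_neg_one_pow hodd] at h1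
    have h2 : (Fintype.card F - 1) / 2 = Fintype.card F / 2 := by omega
    change ((quadraticChar F (-1) : ℤ) : ℂ) = _
    rw [h1, h2]
    push_cast
    rfl
  have hpow (x : F) : ∃ i : ℕ, ζ ^ i = ψ x := by
    have : NeZero p := ⟨(Fact.out : p.Prime).ne_zero⟩
    obtain ⟨i, -, hi⟩ := hζ.eq_pow_of_pow_eq_one (ξ := ψ x) (by
      rw [← AddChar.map_nsmul_eq_pow, nsmul_eq_mul, CharP.cast_eq_zero, zero_mul,
        AddChar.map_zero_eq_one])
    exact ⟨i, hi⟩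
  choose i hi using hpow
  let Q : ℚ[X] := ∑ x : F, C (quadraticChar F x : ℚ) * X ^ i x
  have hQ (t : ℕ) : aeval (ζ ^ t) Q = gaussSum χ (ψ.mulShift t) := by
    simp only [Q, map_sum, gaussSum]
    refine Finset.sum_congr rfl fun x _ => ?_
    have h1 : (ζ ^ t) ^ i x = ψ (t * x) := by
      rw [← pow_mul, mul_comm, pow_mul, hi, ← nsmul_eq_mul, AddChar.map_nsmul_eq_pow]
    have h2 : χ x = ((quadraticChar F x : ℤ) : ℂ) := rfl
    simp [h1, h2]
  have hQ1 : aeval ζ Q = gaussSum χ ψ := by simpa using hQ 1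
  have hQt (t : ℕ) (ht : t.Coprime p) :
      ((quadraticChar F t : ℤ) : ℂ) * aeval (ζ ^ t) Q = gaussSum χ ψ := by
    have h0 : (t : F) ≠ 0 := by
      rw [Ne, CharP.cast_eq_zero_iff F p]
      exact fun h => (Nat.Prime.coprime_iff_not_dvd Fact.out).1 ht.symm h
    rw [hQ]
    exact gaussSum_mulShift χ ψ (Units.mk0 (t : F) h0)
  have hsquare (t : ℕ) (ht : t.Coprime p) : quadraticChar F t = 1 ↔ IsSquare (t : F) := by
    refine quadraticChar_one_iff_isSquare ?_
    rw [Ne, CharP.cast_eq_zero_iff F p]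
    exact fun h => (Nat.Prime.coprime_iff_not_dvd Fact.out).1 ht.symm h
  rcases sq_eq_sq_iff_eq_or_eq_neg.1 hsq with h | h
  · exact ⟨Q, hQ1.trans h, fun t ht => ⟨_, hsquare t ht, (hQt t ht).trans h⟩⟩
  · refine ⟨-Q, by rw [map_neg, hQ1, h, neg_neg], fun t ht => ⟨_, hsquare t ht, ?_⟩⟩
    rw [map_neg, mul_neg, hQt t ht, h, neg_neg]

theorem eq_or_mul_eq_one_of_add_inv_eq {K : Type*} [Field K] {a b : K} (ha : a ≠ 0)
    (hb : b ≠ 0) (h : a + a⁻¹ = b + b⁻¹) : a = b ∨ a * b = 1 := by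
  have h1 : (a - b) * (a * b - 1) = 0 := by
    field_simp at h
    linear_combination h
  rcases mul_eq_zero.1 h1 with h2 | h2
  · exact Or.inl (sub_eq_zero.1 h2)
  · exact Or.inr (sub_eq_zero.1 h2)

namespace Matrix.SpecialLinearGroup

theorem isConj_pow_iff_of_coprime {F : Type*} [Field F] [Finite F] {p d t : ℕ} [Fact p.Prime]
    [CharP F p] (hp : Odd p) (hpd : p.Coprime d) (ht : t ≠ 0)
    {g : SpecialLinearGroup (Fin 2) F} (hg : orderOf g = d) :
    IsConj (g ^ t) g ↔ d ∣ t - 1 ∨ d ∣ t + 1 := by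
  constructor
  · intro h
    obtain ⟨l, hl0, hl⟩ := exists_trace_pow_eq g
    have htr : (g ^ t).1.trace = g.1.trace := by
      obtain ⟨c, hc⟩ := isConj_iff.1 h
      have h1 : (c * g ^ t * c⁻¹).1.trace = (g ^ t).1.trace := by
        rw [coe_mul, trace_mul_comm, ← coe_mul, inv_mul_cancel_left]
      rw [← h1, hc]
    have hone (k : ℕ) (hk : l ^ k = 1) : d ∣ k := by
      rw [← hg]
      refine orderOf_dvd_of_pow_eq_one (eq_one_of_trace_eq_two (p := p) (d := d) ?_ ?_ hpd)
      · apply (algebraMap F (AlgebraicClosure F)).injective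
        rw [hl, hk, inv_one, map_ofNat]
        norm_num
      · rw [← hg, pow_right_comm, pow_orderOf_eq_one, one_pow]
    have h1 : l ^ t + (l ^ t)⁻¹ = l + l⁻¹ := by
      rw [← hl, htr]
      simpa using hl 1
    rcases eq_or_mul_eq_one_of_add_inv_eq (pow_ne_zero t hl0) hl0 h1 with h2 | h2
    · refine Or.inl (hone _ (mul_right_cancel₀ hl0 ?_))
      rw [← pow_succ, Nat.sub_add_cancel (Nat.one_le_iff_ne_zero.2 ht), h2, one_mul]
    · exact Or.inr (hone _ (by rw [pow_succ, h2]))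
  · rintro (h | h)
    · rw [← hg, orderOf_dvd_iff_pow_eq_one] at h
      rw [← Nat.sub_add_cancel (Nat.one_le_iff_ne_zero.2 ht), pow_succ, h, one_mul]
    · rw [← hg, orderOf_dvd_iff_pow_eq_one, pow_succ] at h
      rw [eq_inv_of_mul_eq_one_left h]
      exact (isConj_inv_of_pow_eq_one hp (by rw [← hg, pow_orderOf_eq_one]) hpd).symm

theorem orderOf_eq_char_pow {F : Type*} [Field F] {p r : ℕ} [Fact p.Prime] [CharP F p]
    {g : SpecialLinearGroup (Fin 2) F} (hr : r ≠ 0) (hg : orderOf g = p ^ r) : p ^ r = p := by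
  have h1 := orderOf_dvd_of_pow_eq_one
    (pow_char_eq_one (trace_eq_two_of_pow_char_pow_eq_one (g := g) (p := p) (r := r)
      (by rw [← hg, pow_orderOf_eq_one])))
  rw [hg] at h1
  exact Nat.dvd_antisymm h1 (dvd_pow_self p hr)

end Matrix.SpecialLinearGroup

open Polynomial in
theorem charFieldAt_SL_two_of_coprime {F : Type} [Field F] [Finite F] {p d : ℕ} [Fact p.Prime]
    [CharP F p] (hp : Odd p) (hpd : p.Coprime d) (hd : 1 < d)
    (hex : ∃ g : Matrix.SpecialLinearGroup (Fin 2) F, orderOf g = d) :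
    charFieldAt (Matrix.SpecialLinearGroup (Fin 2) F) d =
      IntermediateField.adjoin ℚ {zeta d + (zeta d)⁻¹} := by
  have : NeZero d := ⟨by omega⟩
  have hζ := isPrimitiveRoot_zeta d
  have hζ0 : zeta d ≠ 0 := hζ.ne_zero (NeZero.ne d)
  have hQ (t : ℕ) : aeval (zeta d ^ t) (X + X ^ (d - 1) : ℚ[X]) =
      zeta d ^ t + (zeta d ^ t)⁻¹ := by
    have h1 : (zeta d ^ t) ^ (d - 1) = (zeta d ^ t)⁻¹ := by
      refine eq_inv_of_mul_eq_one_left ?_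
      rw [← pow_succ, Nat.sub_add_cancel hd.le, pow_right_comm, hζ.pow_eq_one, one_pow]
    simp [h1]
  have hQ1 : aeval (zeta d) (X + X ^ (d - 1) : ℚ[X]) = zeta d + (zeta d)⁻¹ := by
    simpa using hQ 1
  rw [charFieldAt_eq_adjoin (X + X ^ (d - 1)), hQ1]
  intro t ht
  have ht0 : t ≠ 0 := by
    rintro rfl
    rw [Nat.coprime_zero_left] at ht
    omega
  have hgrp : (∀ g : Matrix.SpecialLinearGroup (Fin 2) F, orderOf g = d → IsConj (g ^ t) g) ↔
      d ∣ t - 1 ∨ d ∣ t + 1 := by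
    obtain ⟨g, hg⟩ := hex
    exact ⟨fun h => (Matrix.SpecialLinearGroup.isConj_pow_iff_of_coprime hp hpd ht0 hg).1 (h g hg),
      fun h g hg => (Matrix.SpecialLinearGroup.isConj_pow_iff_of_coprime hp hpd ht0 hg).2 h⟩
  rw [hgrp, hQ, hQ1, ← hζ.pow_eq_one_iff_dvd, ← hζ.pow_eq_one_iff_dvd]
  have hsub : zeta d ^ t = zeta d ^ (t - 1) * zeta d := by
    rw [← pow_succ, Nat.sub_add_cancel (Nat.one_le_iff_ne_zero.2 ht0)]
  constructor
  · intro h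
    rcases eq_or_mul_eq_one_of_add_inv_eq (pow_ne_zero t hζ0) hζ0 h with h2 | h2
    · exact Or.inl (mul_right_cancel₀ hζ0 (by rw [← hsub, h2, one_mul]))
    · exact Or.inr (by rw [pow_succ, h2])
  · rintro (h | h)
    · rw [hsub, h, one_mul]
    · rw [pow_succ] at h
      rw [eq_inv_of_mul_eq_one_left h, inv_inv, add_comm]

theorem charFieldAt_SL_two_char {F : Type} [Field F] [Fintype F] {p : ℕ} [Fact p.Prime]
    [CharP F p] (hp : p ≠ 2) {s : ℂ}
    (hs : s ^ 2 = (-1) ^ ((Fintype.card F - 1) / 2) * (Fintype.card F : ℂ)) :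
    charFieldAt (Matrix.SpecialLinearGroup (Fin 2) F) p = IntermediateField.adjoin ℚ {s} := by
  have : NeZero p := ⟨(Fact.out : p.Prime).ne_zero⟩
  obtain ⟨Q, hQ, hQt⟩ := exists_polynomial_aeval_eq_sqrt hp hs (isPrimitiveRoot_zeta p)
  have hs0 : s ≠ 0 := by
    rintro rfl
    simp at hs
  rw [← hQ]
  refine charFieldAt_eq_adjoin Q fun t ht => ?_
  obtain ⟨e, he, heQ⟩ := hQt t ht
  have h1 : Polynomial.aeval (zeta p ^ t) Q = Polynomial.aeval (zeta p) Q ↔ e = 1 := by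
    rw [hQ]
    constructor
    · intro h
      rw [h] at heQ
      exact_mod_cast (mul_eq_right₀ hs0).1 heQ
    · rintro rfl
      simpa using heQ
  rw [h1, he]
  constructor
  · rintro ⟨w, hw⟩ g hg
    have hg2 : g.1.trace = 2 :=
      Matrix.SpecialLinearGroup.trace_eq_two_of_pow_char_pow_eq_one (p := p) (r := 1)
        (by rw [pow_one, ← hg, pow_orderOf_eq_one])
    refine Matrix.SpecialLinearGroup.isConj_pow_of_trace_eq_two hg2 (w := w) ?_ (by rw [hw, sq])
    rintro rfl
    rw [mul_zero, CharP.cast_eq_zero_iff F p] at hw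
    exact (Nat.Prime.coprime_iff_not_dvd Fact.out).1 ht.symm hw
  · intro h
    obtain ⟨w, -, hw⟩ := Matrix.SpecialLinearGroup.exists_sq_eq_of_isConj_unipotent_pow
      (h _ Matrix.SpecialLinearGroup.orderOf_unipotent)
    exact ⟨w, by rw [hw, sq]⟩

/-- For `q = p^n` with `p` an odd prime, if `SL_2(F_q)` contains an element
of order `ℓ^r`, then `K_{ℓ^r}(SL_2(F_q)) = ℚ(ζ_{ℓ^r} + ζ_{ℓ^r}^{−1})` when
`q ≡ ±1 (mod ℓ^r)`, and `K_{ℓ^r}(SL_2(F_q)) = ℚ(√(q*))` when `q ≡ 0 (mod ℓ^r)`, where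
`q* = (−1)^{(q−1)/2} q` and `s` is any complex square root of `q*`. -/
theorem statement9 (p n q ℓ r : ℕ) (hp : p.Prime) (hodd : Odd p) (hn : 1 ≤ n)
    (hq : q = p ^ n) (hℓ : ℓ.Prime) (hr : 1 ≤ r)
    (F : Type) [Field F] [Fintype F] (hF : Fintype.card F = q)
    (hex : ∃ g : Matrix.SpecialLinearGroup (Fin 2) F, orderOf g = ℓ ^ r)
    (s : ℂ) (hs : s ^ 2 = (-1) ^ ((q - 1) / 2) * (q : ℂ)) :
    (((q : ZMod (ℓ ^ r)) = 1 ∨ (q : ZMod (ℓ ^ r)) = -1) →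
      charFieldAt (Matrix.SpecialLinearGroup (Fin 2) F) (ℓ ^ r) =
        IntermediateField.adjoin ℚ {zeta (ℓ ^ r) + (zeta (ℓ ^ r))⁻¹}) ∧
    ((q : ZMod (ℓ ^ r)) = 0 →
      charFieldAt (Matrix.SpecialLinearGroup (Fin 2) F) (ℓ ^ r) =
        IntermediateField.adjoin ℚ {s}) := by
  have : Fact p.Prime := ⟨hp⟩
  have : CharP F p := by
    have : CharP F (ringChar F) := ringChar.charP F
    obtain ⟨m, hprime, hm⟩ := FiniteField.card F (ringChar F)
    rw [hF, hq] at hm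
    have : p = ringChar F := by
      refine (Nat.prime_dvd_prime_iff_eq hp hprime).1 (hp.dvd_of_dvd_pow (n := m) ?_)
      rw [← hm]
      exact dvd_pow_self p (by omega)
    rwa [this]
  have hr0 : r ≠ 0 := by omega
  have hd : 1 < ℓ ^ r := Nat.one_lt_pow hr0 hℓ.one_lt
  constructor
  · intro h
    refine charFieldAt_SL_two_of_coprime hodd ?_ hd hex
    have hunit : IsUnit (q : ZMod (ℓ ^ r)) := by
      rcases h with h | h <;> rw [h]
      · exact isUnit_one
      · exact isUnit_one.neg
    rw [ZMod.isUnit_iff_coprime, hq] at hunit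
    exact Nat.Coprime.coprime_dvd_left (dvd_pow_self p (by omega)) hunit
  · intro h
    rw [ZMod.natCast_eq_zero_iff, hq] at h
    have hℓp : ℓ = p := (Nat.prime_dvd_prime_iff_eq hℓ hp).1
      (hℓ.dvd_of_dvd_pow ((dvd_pow_self ℓ hr0).trans h))
    subst hℓp
    obtain ⟨g, hg⟩ := hex
    rw [Matrix.SpecialLinearGroup.orderOf_eq_char_pow hr0 hg]
    refine charFieldAt_SL_two_char ?_ (by rw [hF]; exact hs)
    rintro rfl
    exact absurd hodd (by decide)
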